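/- Let f: ℝⁿ → ℝ be differentiable and ℓ-strongly convex, i.e., f(z) ≥ f(x) + ⟨∇f(x), z - x⟩ + (ℓ/2)‖z - x‖² for all x, z, with ℓ > 0. Let p: ℝⁿ → ℝ ∪ {+∞} be proper, λ > 0, and τ > 1/ℓ. If x* ∈ argmin_y { (1/2)‖y - (x* - τ∇f(x*))‖² + τλ p(y) }, then x* is the unique global minimizer of φ(x) = f(x) + λp(x). -/

import Mathlib

open RealInnerProductSpace

/-- if f is ℓ-strongly convex, τ > 1/ℓ and x* is a τ-stationary
(proximal fixed) point, then x* is the unique global minimizer of f + λp. -/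
theorem stmt7 (n : ℕ) (f : EuclideanSpace ℝ (Fin n) → ℝ)
    (g : EuclideanSpace ℝ (Fin n) → EuclideanSpace ℝ (Fin n))
    (hf : ∀ y, HasGradientAt f (g y) y)
    (ℓ : ℝ) (hℓ : 0 < ℓ)
    (hconv : ∀ x z, f z ≥ f x + ⟪g x, z - x⟫ + ℓ / 2 * ‖z - x‖ ^ 2)
    (p : EuclideanSpace ℝ (Fin n) → EReal)
    (hproper : ∃ x, p x ≠ ⊤) (hbot : ∀ x, p x ≠ ⊥)
    (lam : ℝ) (hlam : 0 < lam)
    (τ : ℝ) (hτ : τ > 1 / ℓ)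
    (xs : EuclideanSpace ℝ (Fin n)) (hps : p xs ≠ ⊤)
    (hmin : ∀ w,
      ((1 / 2 * ‖xs - (xs - τ • g xs)‖ ^ 2 : ℝ) : EReal) + ((τ * lam : ℝ) : EReal) * p xs ≤
      ((1 / 2 * ‖w - (xs - τ • g xs)‖ ^ 2 : ℝ) : EReal) + ((τ * lam : ℝ) : EReal) * p w) :
    ∀ x, x ≠ xs →
      (f xs : EReal) + (lam : EReal) * p xs < (f x : EReal) + (lam : EReal) * p x := by
  intro x hx
  have hbot' := hbot x
  have hsbot := hbot xs
  have hw := hmin x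
  have hc := hconv xs x
  have hτ0 : 0 < τ := (one_div_pos.2 hℓ).trans hτ
  have hτℓ : 1 < τ * ℓ := (div_lt_iff₀ hℓ).1 hτ
  generalize p x = b at *
  generalize p xs = a at *
  lift a to ℝ using ⟨hps, hsbot⟩
  induction b with
  | bot => exact absurd rfl hbot'
  | top =>
    rw [EReal.coe_mul_top_of_pos hlam, EReal.coe_add_top]
    exact_mod_cast EReal.coe_lt_top (f xs + lam * a)
  | coe b =>
    norm_cast at hw ⊢
    have hd : 0 < ‖x - xs‖ ^ 2 := pow_pos (norm_pos_iff.2 (sub_ne_zero.2 hx)) 2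
    have hexp : ‖x - (xs - τ • g xs)‖ ^ 2
        = ‖x - xs‖ ^ 2 + 2 * (τ * ⟪g xs, x - xs⟫) + ‖τ • g xs‖ ^ 2 := by
      rw [show x - (xs - τ • g xs) = (x - xs) + τ • g xs by abel, norm_add_sq_real,
        real_inner_smul_right, real_inner_comm]
    rw [hexp, sub_sub_cancel] at hw
    refine lt_of_mul_lt_mul_left ?_ hτ0.le
    nlinarith [mul_le_mul_of_nonneg_left hc hτ0.le, mul_pos (sub_pos.2 hτℓ) hd]
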